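/- arXiv:2112.13190 — 2 statements merged into one kernel-verified Lean document; each statement's English description precedes it below -/
import Mathlib

section
/- For every ε > 0 there exists a constant c = c(ε) > 0 such that the following holds: for every finite graph G and every probability p with 0 < p ≤ 1 satisfying e(G)·p ≥ c, the random subgraph G_p satisfies q*(G_p) > q*(G) − ε with probability at least 1 − ε. -/
open Finset
open scoped Classical

/-- The number of edges of a finite graph. -/
noncomputable def edgeCount {V : Type} [Fintype V] [DecidableEq V] (G : SimpleGraph V) : ℕ :=
  G.edgeFinset.card

/-- vol(A): the sum over vertices of A of their degree in G. -/
noncomputable def degSum {V : Type} [Fintype V] [DecidableEq V] (G : SimpleGraph V)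
    (A : Finset V) : ℕ :=
  ∑ v ∈ A, G.degree v

/-- e(A): the number of edges of G with both endpoints in A. -/
noncomputable def intEdges {V : Type} [Fintype V] [DecidableEq V] (G : SimpleGraph V)
    (A : Finset V) : ℕ :=
  (G.edgeFinset.filter (fun e => ∀ v ∈ e, v ∈ A)).card

/-- The modularity score q_𝒜(G) of a vertex partition 𝒜 of G; it is 0 if G has no edges. -/
noncomputable def modScore {V : Type} [Fintype V] [DecidableEq V] (G : SimpleGraph V)
    (P : Finpartition (univ : Finset V)) : ℝ :=
  if edgeCount G = 0 then 0 else
    (∑ A ∈ P.parts, (intEdges G A : ℝ)) / (edgeCount G : ℝ)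
      - (∑ A ∈ P.parts, (degSum G A : ℝ) ^ 2) / (4 * (edgeCount G : ℝ) ^ 2)

/-- The modularity q*(G) of a graph: the maximum of q_𝒜(G) over all vertex partitions 𝒜. -/
noncomputable def modularity {V : Type} [Fintype V] [DecidableEq V] (G : SimpleGraph V) : ℝ :=
  ⨆ P : Finpartition (univ : Finset V), modScore G P

/-- The probability that the random subgraph G_p of G (each edge of G retained
independently with probability p) satisfies the predicate Q. -/
noncomputable def subgraphProb {V : Type} [Fintype V] [DecidableEq V] (G : SimpleGraph V)
    (p : ℝ) (Q : SimpleGraph V → Prop) : ℝ :=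
  ∑ F ∈ G.edgeFinset.powerset,
    if Q (SimpleGraph.fromEdgeSet (F : Set (Sym2 V))) then
      p ^ F.card * (1 - p) ^ (G.edgeFinset.card - F.card)
    else 0

/-- The average of `f` over random subsets of `E` whose elements are kept independently with
probability `p`. -/
noncomputable def bernoulliAvg {α : Type*} (E : Finset α) (p : ℝ) (f : Finset α → ℝ) : ℝ :=
  ∑ F ∈ E.powerset, p ^ F.card * (1 - p) ^ (E.card - F.card) * f F

theorem bernoulliAvg_one {α : Type*} (E : Finset α) (p : ℝ) :
    bernoulliAvg E p (fun _ => 1) = 1 := by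
  simp [bernoulliAvg, Finset.sum_pow_mul_eq_add_pow]

theorem bernoulliAvg_add {α : Type*} (E : Finset α) (p : ℝ) (f g : Finset α → ℝ) :
    bernoulliAvg E p (fun F => f F + g F) = bernoulliAvg E p f + bernoulliAvg E p g := by
  simp [bernoulliAvg, mul_add, Finset.sum_add_distrib]

theorem bernoulliAvg_sum {α ι : Type*} (E : Finset α) (p : ℝ) (s : Finset ι)
    (f : ι → Finset α → ℝ) :
    bernoulliAvg E p (fun F => ∑ j ∈ s, f j F) = ∑ j ∈ s, bernoulliAvg E p (f j) := by
  simp only [bernoulliAvg, Finset.mul_sum]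
  exact Finset.sum_comm

theorem bernoulliAvg_mono {α : Type*} {E : Finset α} {p : ℝ} (hp : 0 ≤ p) (hp1 : p ≤ 1)
    {f g : Finset α → ℝ} (h : ∀ F ⊆ E, f F ≤ g F) :
    bernoulliAvg E p f ≤ bernoulliAvg E p g := by
  refine Finset.sum_le_sum fun F hF => mul_le_mul_of_nonneg_left (h F (mem_powerset.1 hF)) ?_
  have : 0 ≤ 1 - p := by linarith
  positivity

theorem bernoulliAvg_insert {α : Type*} {E : Finset α} {a : α} (ha : a ∉ E) (p : ℝ)
    (f : Finset α → ℝ) :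
    bernoulliAvg (insert a E) p f =
      (1 - p) * bernoulliAvg E p f + p * bernoulliAvg E p (fun F => f (insert a F)) := by
  unfold bernoulliAvg
  rw [Finset.sum_powerset_insert ha, Finset.mul_sum, Finset.mul_sum]
  congr 1 <;> refine Finset.sum_congr rfl fun F hF => ?_
  · have hc := Finset.card_le_card (mem_powerset.1 hF)
    rw [Finset.card_insert_of_notMem ha, Nat.succ_sub hc, pow_succ]
    ring
  · rw [Finset.card_insert_of_notMem ha,
      Finset.card_insert_of_notMem fun h => ha (mem_powerset.1 hF h), Nat.add_sub_add_right,
      pow_succ]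
    ring

theorem bernoulliAvg_sq_add {α : Type*} (E : Finset α) (p : ℝ) (w : α → ℝ) (t : ℝ) :
    bernoulliAvg E p (fun F => (∑ e ∈ F, w e - p * ∑ e ∈ E, w e + t) ^ 2) =
      p * (1 - p) * ∑ e ∈ E, w e ^ 2 + t ^ 2 := by
  induction E using Finset.induction_on generalizing t with
  | empty => simp [bernoulliAvg]
  | insert a E ha ih =>
    rw [bernoulliAvg_insert ha, Finset.sum_insert ha, Finset.sum_insert ha]
    have h1 := ih (t - p * w a)
    have h2 := ih (t + (1 - p) * w a)
    have e2 : bernoulliAvg E p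
          (fun F => (∑ e ∈ insert a F, w e - p * (w a + ∑ e ∈ E, w e) + t) ^ 2) =
        bernoulliAvg E p
          (fun F => (∑ e ∈ F, w e - p * ∑ e ∈ E, w e + (t + (1 - p) * w a)) ^ 2) := by
      refine Finset.sum_congr rfl fun F hF => ?_
      simp only [Finset.sum_insert fun h => ha (mem_powerset.1 hF h)]
      ring
    have e1 : bernoulliAvg E p (fun F => (∑ e ∈ F, w e - p * (w a + ∑ e ∈ E, w e) + t) ^ 2) =
        bernoulliAvg E p
          (fun F => (∑ e ∈ F, w e - p * ∑ e ∈ E, w e + (t - p * w a)) ^ 2) :=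
      Finset.sum_congr rfl fun F _ => by ring
    rw [e1, e2, h1, h2]
    ring

/-- The second moment of a centred weighted count of retained elements. -/
theorem bernoulliAvg_sq_le {α : Type*} (E : Finset α) {p : ℝ} (hp : 0 ≤ p) (w : α → ℝ) :
    bernoulliAvg E p (fun F => (∑ e ∈ F, w e - p * ∑ e ∈ E, w e) ^ 2) ≤
      p * ∑ e ∈ E, w e ^ 2 := by
  have h := bernoulliAvg_sq_add E p w 0
  simp only [add_zero] at h
  rw [h]
  have : 0 ≤ ∑ e ∈ E, w e ^ 2 := Finset.sum_nonneg fun _ _ => sq_nonneg _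
  nlinarith [mul_nonneg (mul_nonneg hp hp) this]

/-- Markov's inequality for `bernoulliAvg`. -/
theorem one_sub_le_bernoulliAvg_indicator {α : Type*} {E : Finset α} {p : ℝ} (hp : 0 ≤ p)
    (hp1 : p ≤ 1) {D : Finset α → ℝ} (hD : ∀ F, 0 ≤ D F) {a ε : ℝ} (ha : 0 < a)
    (hE : bernoulliAvg E p D ≤ ε * a) {Q : Finset α → Prop}
    (hQ : ∀ F ⊆ E, D F < a → Q F) :
    1 - ε ≤ bernoulliAvg E p (fun F => if Q F then 1 else 0) := by
  have h : bernoulliAvg E p (fun _ => 1) ≤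
      bernoulliAvg E p (fun F => (if Q F then 1 else 0) + D F * a⁻¹) := by
    refine bernoulliAvg_mono hp hp1 fun F hF => ?_
    have h0 : 0 ≤ D F * a⁻¹ := mul_nonneg (hD F) (inv_nonneg.2 ha.le)
    split_ifs with hq
    · linarith
    · have : a ≤ D F := not_lt.1 fun h => hq (hQ F hF h)
      rw [zero_add, ← div_eq_mul_inv, one_le_div ha]
      exact this
  have hm : bernoulliAvg E p (fun F => D F * a⁻¹) = bernoulliAvg E p D * a⁻¹ := by
    simp only [bernoulliAvg, ← mul_assoc, Finset.sum_mul]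
  rw [bernoulliAvg_one, bernoulliAvg_add, hm] at h
  have : bernoulliAvg E p D * a⁻¹ ≤ ε := by
    rw [← div_eq_mul_inv, div_le_iff₀ ha]
    exact hE
  linarith

theorem edgeFinset_fromEdgeSet_of_subset {V : Type} [Fintype V] {G : SimpleGraph V}
    {F : Finset (Sym2 V)} [Fintype (SimpleGraph.fromEdgeSet (F : Set (Sym2 V))).edgeSet] (hF : F ⊆ G.edgeFinset) :
    (SimpleGraph.fromEdgeSet (F : Set (Sym2 V))).edgeFinset = F := by
  ext e
  simp only [SimpleGraph.mem_edgeFinset, SimpleGraph.edgeSet_fromEdgeSet, Set.mem_sdiff,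
    mem_coe]
  exact ⟨fun h => h.1, fun h =>
    ⟨h, G.not_isDiag_of_mem_edgeSet (SimpleGraph.mem_edgeFinset.1 (hF h))⟩⟩

section Weights

variable {V : Type} [Fintype V] [DecidableEq V]

/-- The number of endpoints of `e` in `A`. -/
noncomputable def endpointsIn (A : Finset V) (e : Sym2 V) : ℕ :=
  (A.filter fun v => v ∈ e).card

/-- The number of parts of `P` containing all endpoints of `e`. -/
noncomputable def internalWeight (P : Finpartition (univ : Finset V)) (e : Sym2 V) : ℕ :=
  (P.parts.filter fun A => ∀ v ∈ e, v ∈ A).card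

theorem degSum_eq_sum_endpointsIn (G : SimpleGraph V) (A : Finset V) :
    degSum G A = ∑ e ∈ G.edgeFinset, endpointsIn A e := by
  have h : ∀ v, G.degree v = (G.edgeFinset.filter fun e => v ∈ e).card := fun v => by
    rw [← SimpleGraph.card_incidenceFinset_eq_degree, SimpleGraph.incidenceFinset_eq_filter]
  simp only [degSum, endpointsIn, h]
  exact Finset.sum_card_bipartiteAbove_eq_sum_card_bipartiteBelow (fun v e => v ∈ e)

theorem sum_intEdges_eq_sum_internalWeight (G : SimpleGraph V)
    (P : Finpartition (univ : Finset V)) :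
    ∑ A ∈ P.parts, intEdges G A = ∑ e ∈ G.edgeFinset, internalWeight P e :=
  Finset.sum_card_bipartiteAbove_eq_sum_card_bipartiteBelow
    (fun (A : Finset V) (e : Sym2 V) => ∀ v ∈ e, v ∈ A)

theorem sum_endpointsIn (G : SimpleGraph V) (P : Finpartition (univ : Finset V))
    {e : Sym2 V} (he : e ∈ G.edgeFinset) : ∑ A ∈ P.parts, endpointsIn A e = 2 := by
  have h : ∑ A ∈ P.parts, endpointsIn A e = (univ.filter fun v => v ∈ e).card := by
    simp only [endpointsIn, Finset.card_filter]
    refine (Finset.sum_biUnion (t := id) P.supIndep.pairwiseDisjoint).symm.trans ?_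
    exact congrArg (fun s : Finset V => ∑ v ∈ s, if v ∈ e then 1 else 0) P.biUnion_parts
  rw [h]
  rw [SimpleGraph.mem_edgeFinset] at he
  rw [← Sym2.card_toFinset_of_not_isDiag e (G.not_isDiag_of_mem_edgeSet he)]
  congr 1
  ext v
  simp

theorem internalWeight_le_one (G : SimpleGraph V) (P : Finpartition (univ : Finset V))
    {e : Sym2 V} (he : e ∈ G.edgeFinset) : internalWeight P e ≤ 1 := by
  have h : ∑ A ∈ P.parts, (if ∀ v ∈ e, v ∈ A then 2 else 0) ≤
      ∑ A ∈ P.parts, endpointsIn A e := by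
    refine Finset.sum_le_sum fun A _ => ?_
    split_ifs with hA
    · rw [SimpleGraph.mem_edgeFinset] at he
      rw [← Sym2.card_toFinset_of_not_isDiag e (G.not_isDiag_of_mem_edgeSet he)]
      refine Finset.card_le_card fun v hv => ?_
      rw [Sym2.mem_toFinset] at hv
      exact mem_filter.2 ⟨hA v hv, hv⟩
    · exact Nat.zero_le _
  rw [sum_endpointsIn G P he, ← Finset.sum_filter, Finset.sum_const, smul_eq_mul] at h
  unfold internalWeight
  omega

theorem sum_endpointsIn_sq_le (G : SimpleGraph V) (P : Finpartition (univ : Finset V))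
    {e : Sym2 V} (he : e ∈ G.edgeFinset) :
    ∑ A ∈ P.parts, (endpointsIn A e : ℝ) ^ 2 ≤ 4 := by
  have h := Finset.sum_sq_le_sq_sum_of_nonneg (s := P.parts)
    (f := fun A => (endpointsIn A e : ℝ)) fun _ _ => Nat.cast_nonneg _
  have h2 : ∑ A ∈ P.parts, (endpointsIn A e : ℝ) = 2 := mod_cast sum_endpointsIn G P he
  rw [h2] at h
  linarith

theorem sum_degSum (G : SimpleGraph V) (P : Finpartition (univ : Finset V)) :
    ∑ A ∈ P.parts, degSum G A = 2 * edgeCount G := by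
  simp only [degSum_eq_sum_endpointsIn]
  rw [Finset.sum_comm, Finset.sum_congr rfl fun e he => sum_endpointsIn G P he]
  simp [edgeCount, mul_comm]

end Weights

/-- A perturbation bound: if the normalised observed counts are within `η` of the true ones,
the score drops by at most `14 η`. -/
theorem score_perturbation {η a σ x y z : ℝ} (hη : 0 < η) (hη2 : η ≤ 1 / 2) (ha : 0 ≤ a)
    (ha1 : a ≤ 1) (hσ : 0 ≤ σ) (hσ1 : σ ≤ 1) (hx : a - η ≤ x)
    (hy : 1 - η ≤ y) (hy1 : y ≤ 1 + η) (hz : z ≤ σ + 3 / 2 * η) :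
    a - σ - 14 * η ≤ x / y - z / y ^ 2 := by
  have hy0 : 0 < y := by linarith
  have h1 : a - 2 * η ≤ x / y := by
    rw [le_div_iff₀ hy0]
    by_cases h : a - 2 * η ≤ 0
    · nlinarith
    · nlinarith
  have h2 : z / y ^ 2 ≤ σ + 12 * η := by
    rw [div_le_iff₀ (by positivity)]
    have hy2 : (1 - η) ^ 2 ≤ y ^ 2 := by nlinarith
    have h3 : (σ + 12 * η) * (1 - η) ^ 2 ≤ (σ + 12 * η) * y ^ 2 :=
      mul_le_mul_of_nonneg_left hy2 (by positivity)
    have h4 : σ + 3 / 2 * η ≤ (σ + 12 * η) * (1 - η) ^ 2 := by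
      nlinarith [mul_nonneg hη.le (sub_nonneg.2 hσ1), mul_nonneg hη.le (sub_nonneg.2 hη2),
        mul_nonneg (mul_nonneg hη.le hη.le) (sub_nonneg.2 hη2),
        mul_nonneg (mul_nonneg hη.le hη.le) hσ]
    linarith
  linarith

/-- `score_perturbation` for unnormalised counts. -/
theorem score_ge_of_close {η p m i s I M S : ℝ} (hη : 0 < η) (hη2 : η ≤ 1 / 2) (hm : 0 < m)
    (hp : 0 < p) (hi0 : 0 ≤ i) (hi : i ≤ m) (hs0 : 0 ≤ s) (hs : s ≤ 4 * m ^ 2)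
    (hD : (I - p * i) ^ 2 + (M - p * m) ^ 2 ≤ (η * (m * p)) ^ 2)
    (hS : S ≤ p ^ 2 * s + 6 * η * (m ^ 2 * p ^ 2)) :
    0 < M ∧ i / m - s / (4 * m ^ 2) - 14 * η ≤ I / M - S / (4 * M ^ 2) := by
  have hμ : 0 < m * p := mul_pos hm hp
  have hημ : 0 < η * (m * p) := mul_pos hη hμ
  have hI := abs_le_of_sq_le_sq' (a := I - p * i) (b := η * (m * p))
    (by linarith [sq_nonneg (M - p * m)]) hημ.le
  have hM := abs_le_of_sq_le_sq' (a := M - p * m) (b := η * (m * p))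
    (by linarith [sq_nonneg (I - p * i)]) hημ.le
  have hM0 : 0 < M := by nlinarith
  refine ⟨hM0, ?_⟩
  have key := score_perturbation (a := i / m) (σ := s / (4 * m ^ 2)) (x := I / (m * p))
    (y := M / (m * p)) (z := S / (4 * (m * p) ^ 2)) hη hη2 (by positivity)
    ((div_le_one hm).2 hi) (by positivity) ((div_le_one (by positivity)).2 hs)
    (by
      rw [le_div_iff₀ hμ]
      have : i / m * (m * p) = p * i := by field_simp
      linarith)
    (by rw [le_div_iff₀ hμ]; linarith)
    (by rw [div_le_iff₀ hμ]; linarith)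
    (by
      rw [div_le_iff₀ (by positivity)]
      have : s / (4 * m ^ 2) * (4 * (m * p) ^ 2) = p ^ 2 * s := by field_simp
      linarith)
  have e : I / (m * p) / (M / (m * p)) - S / (4 * (m * p) ^ 2) / (M / (m * p)) ^ 2 =
      I / M - S / (4 * M ^ 2) := by
    field_simp
  rwa [e] at key

theorem sum_sq_le_of_close {ι : Type*} (s : Finset ι) (u d : ι → ℝ) {η μ : ℝ} (hη : 0 < η)
    (hη1 : η ≤ 1) (hu : ∑ j ∈ s, u j ^ 2 ≤ 4 * μ ^ 2)
    (hd : ∑ j ∈ s, (d j - u j) ^ 2 ≤ η ^ 2 * μ ^ 2) :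
    ∑ j ∈ s, d j ^ 2 ≤ ∑ j ∈ s, u j ^ 2 + 6 * η * μ ^ 2 := by
  have h : η * ∑ j ∈ s, d j ^ 2 ≤
      η * ((1 + η) * ∑ j ∈ s, u j ^ 2) + (1 + η) * ∑ j ∈ s, (d j - u j) ^ 2 := by
    simp only [Finset.mul_sum, ← Finset.sum_add_distrib]
    refine Finset.sum_le_sum fun j _ => ?_
    nlinarith [sq_nonneg (η * u j - (d j - u j))]
  have h2 : (1 + η) * ∑ j ∈ s, (d j - u j) ^ 2 ≤ (1 + η) * (η ^ 2 * μ ^ 2) :=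
    mul_le_mul_of_nonneg_left hd (by linarith)
  refine le_of_mul_le_mul_left (h.trans ?_) hη
  have h3 : η ^ 2 * ∑ j ∈ s, u j ^ 2 ≤ η ^ 2 * (4 * μ ^ 2) :=
    mul_le_mul_of_nonneg_left hu (sq_nonneg _)
  have h4 : 0 ≤ η ^ 2 * μ ^ 2 * (1 - η) := mul_nonneg (by positivity) (by linarith)
  nlinarith

section Deviation

variable {V : Type} [Fintype V] [DecidableEq V]

/-- The total squared deviation of the statistics of an edge set `F` (edges inside parts, all
edges, volumes of the parts) from their expected values under retention probability `p`. -/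
noncomputable def deviation (G : SimpleGraph V) (P : Finpartition (univ : Finset V)) (p : ℝ)
    (F : Finset (Sym2 V)) : ℝ :=
  (∑ e ∈ F, (internalWeight P e : ℝ) - p * ∑ e ∈ G.edgeFinset, (internalWeight P e : ℝ)) ^ 2 +
    (∑ _e ∈ F, (1 : ℝ) - p * ∑ _e ∈ G.edgeFinset, (1 : ℝ)) ^ 2 +
    ∑ A ∈ P.parts,
      (∑ e ∈ F, (endpointsIn A e : ℝ) - p * ∑ e ∈ G.edgeFinset, (endpointsIn A e : ℝ)) ^ 2

theorem deviation_nonneg (G : SimpleGraph V) (P : Finpartition (univ : Finset V)) (p : ℝ)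
    (F : Finset (Sym2 V)) : 0 ≤ deviation G P p F := by
  unfold deviation
  positivity

theorem bernoulliAvg_deviation_le (G : SimpleGraph V) (P : Finpartition (univ : Finset V))
    {p : ℝ} (hp : 0 ≤ p) :
    bernoulliAvg G.edgeFinset p (deviation G P p) ≤ 6 * (edgeCount G * p) := by
  unfold deviation
  rw [bernoulliAvg_add, bernoulliAvg_add, bernoulliAvg_sum]
  have h1 := bernoulliAvg_sq_le G.edgeFinset hp (fun e => (internalWeight P e : ℝ))
  have h2 := bernoulliAvg_sq_le G.edgeFinset hp (fun _ => (1 : ℝ))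
  have h3 := Finset.sum_le_sum fun A (_ : A ∈ P.parts) =>
    bernoulliAvg_sq_le G.edgeFinset hp (fun e => (endpointsIn A e : ℝ))
  rw [← Finset.mul_sum, Finset.sum_comm] at h3
  have k1 : ∑ e ∈ G.edgeFinset, (internalWeight P e : ℝ) ^ 2 ≤ ∑ e ∈ G.edgeFinset, (1 : ℝ) :=
    Finset.sum_le_sum fun _ he =>
      pow_le_one₀ (Nat.cast_nonneg _) (mod_cast internalWeight_le_one G P he)
  have k3 := Finset.sum_le_sum fun e (he : e ∈ G.edgeFinset) => sum_endpointsIn_sq_le G P he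
  have l1 := mul_le_mul_of_nonneg_left k1 hp
  have l3 := mul_le_mul_of_nonneg_left k3 hp
  simp only [Finset.sum_const, nsmul_eq_mul, mul_one, one_pow] at h2 l1 l3 ⊢
  unfold edgeCount
  linarith

theorem modScore_fromEdgeSet_ge {G : SimpleGraph V} (P : Finpartition (univ : Finset V))
    {p η : ℝ} (hη : 0 < η) (hη2 : η ≤ 1 / 2) (hμ : 0 < (edgeCount G : ℝ) * p)
    {F : Finset (Sym2 V)} (hF : F ⊆ G.edgeFinset)
    (hD : deviation G P p F ≤ η ^ 2 * (edgeCount G * p) ^ 2) :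
    modScore G P - 14 * η ≤ modScore (SimpleGraph.fromEdgeSet (F : Set (Sym2 V))) P := by
  have hHF : ∀ [Fintype (SimpleGraph.fromEdgeSet (F : Set (Sym2 V))).edgeSet],
      (SimpleGraph.fromEdgeSet (F : Set (Sym2 V))).edgeFinset = F :=
    edgeFinset_fromEdgeSet_of_subset hF
  generalize SimpleGraph.fromEdgeSet (F : Set (Sym2 V)) = H at hHF ⊢
  have eI : ∀ K : SimpleGraph V, ∑ A ∈ P.parts, (intEdges K A : ℝ) =
      ∑ e ∈ K.edgeFinset, (internalWeight P e : ℝ) := fun K =>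
    mod_cast sum_intEdges_eq_sum_internalWeight K P
  have eY : ∀ (K : SimpleGraph V) A, (degSum K A : ℝ) =
      ∑ e ∈ K.edgeFinset, (endpointsIn A e : ℝ) := fun K A =>
    mod_cast degSum_eq_sum_endpointsIn K A
  have eM : ∀ K : SimpleGraph V, (edgeCount K : ℝ) = ∑ e ∈ K.edgeFinset, (1 : ℝ) := fun K => by
    simp [edgeCount]
  have eIF : ∑ A ∈ P.parts, (intEdges H A : ℝ) = ∑ e ∈ F, (internalWeight P e : ℝ) := by
    rw [eI, hHF]
  have eYF : ∀ A, (degSum H A : ℝ) = ∑ e ∈ F, (endpointsIn A e : ℝ) := fun A => by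
    rw [eY, hHF]
  have eMF : (edgeCount H : ℝ) = ∑ e ∈ F, (1 : ℝ) := by
    rw [eM, hHF]
  have ha1 : ∑ A ∈ P.parts, (intEdges G A : ℝ) ≤ edgeCount G := by
    rw [eI, eM]
    exact Finset.sum_le_sum fun _ he => mod_cast internalWeight_le_one G P he
  have hσ1 : ∑ A ∈ P.parts, (degSum G A : ℝ) ^ 2 ≤ 4 * (edgeCount G : ℝ) ^ 2 := by
    have h := Finset.sum_sq_le_sq_sum_of_nonneg (s := P.parts)
      (f := fun A => (degSum G A : ℝ)) fun _ _ => Nat.cast_nonneg _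
    have h2 : ∑ A ∈ P.parts, (degSum G A : ℝ) = 2 * edgeCount G := mod_cast sum_degSum G P
    rw [h2] at h
    linarith
  unfold deviation at hD
  rw [← eI G, ← eM G] at hD
  simp only [← eY G] at hD
  rw [← eIF, ← eMF] at hD
  simp only [← eYF] at hD
  have hm : (0 : ℝ) < edgeCount G :=
    lt_of_le_of_ne (Nat.cast_nonneg _) fun h => by simp [← h] at hμ
  have hp : 0 < p := pos_of_mul_pos_right hμ hm.le
  have ha0 : 0 ≤ ∑ A ∈ P.parts, (intEdges G A : ℝ) :=
    Finset.sum_nonneg fun _ _ => Nat.cast_nonneg _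
  have hσ0 : 0 ≤ ∑ A ∈ P.parts, (degSum G A : ℝ) ^ 2 :=
    Finset.sum_nonneg fun _ _ => sq_nonneg _
  have hd0 : 0 ≤ ∑ A ∈ P.parts, ((degSum H A : ℝ) - p * degSum G A) ^ 2 :=
    Finset.sum_nonneg fun _ _ => sq_nonneg _
  have hS := sum_sq_le_of_close P.parts (fun A => p * (degSum G A : ℝ))
    (fun A => (degSum H A : ℝ)) (μ := edgeCount G * p) hη (by linarith)
    (by
      simp only [mul_pow, ← Finset.mul_sum]
      linarith [mul_le_mul_of_nonneg_left hσ1 (sq_nonneg p)])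
    (le_trans (le_add_of_nonneg_left (add_nonneg (sq_nonneg _) (sq_nonneg _))) hD)
  simp only [mul_pow, ← Finset.mul_sum] at hS
  rw [← mul_pow η] at hD
  obtain ⟨hM0, key⟩ := score_ge_of_close hη hη2 hm hp ha0 ha1 hσ0 hσ1
    ((le_add_of_nonneg_right hd0).trans hD) hS
  have hGne : edgeCount G ≠ 0 := fun h => by simp [h] at hm
  have hHne : edgeCount H ≠ 0 := fun h => by simp [h] at hM0
  simpa only [modScore, if_neg hGne, if_neg hHne] using key

theorem modScore_le_modularity (G : SimpleGraph V) (P : Finpartition (univ : Finset V)) :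
    modScore G P ≤ modularity G :=
  le_ciSup (Set.finite_range _).bddAbove P

theorem exists_modScore_eq_modularity (G : SimpleGraph V) :
    ∃ P, modScore G P = modularity G :=
  haveI : Nonempty (Finpartition (univ : Finset V)) := ⟨⊥⟩
  exists_eq_ciSup_of_finite

theorem subgraphProb_eq_bernoulliAvg (G : SimpleGraph V) (p : ℝ) (Q : SimpleGraph V → Prop) :
    subgraphProb G p Q = bernoulliAvg G.edgeFinset p
      (fun F => if Q (SimpleGraph.fromEdgeSet (F : Set (Sym2 V))) then 1 else 0) := by
  simp [subgraphProb, bernoulliAvg]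

end Deviation

/-- Theorem 1 (observed modularity does not drop much):
for every ε > 0 there is c = c(ε) > 0 such that for every finite graph G and
probability 0 < p ≤ 1 with e(G)·p ≥ c, the random subgraph G_p satisfies
q*(G_p) > q*(G) − ε with probability at least 1 − ε. -/
theorem statement0 :
    ∀ ε : ℝ, 0 < ε →
      ∃ c : ℝ, 0 < c ∧
        ∀ (V : Type) [Fintype V] [DecidableEq V] (G : SimpleGraph V) (p : ℝ),
          0 < p → p ≤ 1 → c ≤ (edgeCount G : ℝ) * p →
          1 - ε ≤ subgraphProb G p (fun H => modularity G - ε < modularity H) := by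
  intro ε hε
  obtain ⟨η, hη, hη2, hηε⟩ : ∃ η : ℝ, 0 < η ∧ η ≤ 1 / 2 ∧ 14 * η < ε :=
    ⟨min (1 / 2) (ε / 15), by positivity, min_le_left _ _, by
      linarith [min_le_right (1 / 2) (ε / 15)]⟩
  refine ⟨6 / (ε * η ^ 2), by positivity, fun V _ _ G p hp hp1 hc => ?_⟩
  have hμ : 0 < (edgeCount G : ℝ) * p := lt_of_lt_of_le (by positivity) hc
  obtain ⟨P, hP⟩ := exists_modScore_eq_modularity G
  rw [subgraphProb_eq_bernoulliAvg]
  refine one_sub_le_bernoulliAvg_indicator hp.le hp1 (deviation_nonneg G P p)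
    (a := η ^ 2 * (edgeCount G * p) ^ 2) (by positivity) ?_ fun F hF hD => ?_
  · refine (bernoulliAvg_deviation_le G P hp.le).trans ?_
    rw [div_le_iff₀ (by positivity)] at hc
    nlinarith [mul_le_mul_of_nonneg_right hc hμ.le]
  · have h := modScore_fromEdgeSet_ge P hη hη2 hμ hF hD.le
    have h2 := modScore_le_modularity (SimpleGraph.fromEdgeSet (F : Set (Sym2 V))) P
    linarith
end

section
/- For every ε > 0 there exists a constant c = c(ε) > 0 such that the following holds: for every finite graph G with at least one vertex and every probability p with 0 < p ≤ 1 satisfying e(G)·p / v(G) ≥ c, with probability at least 1 − ε the random subgraph G_p satisfies |q*(G_p) − q*(G)| < ε. -/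
open Finset
open scoped Classical

/-- The contribution of a single vertex set to modularity, with `P` replaced by one set `S`. -/
noncomputable def setScore {V : Type} [Fintype V] [DecidableEq V] (G : SimpleGraph V)
    (S : Finset V) : ℝ :=
  (intEdges G S : ℝ) / (edgeCount G : ℝ) - (degSum G S : ℝ) ^ 2 / (4 * (edgeCount G : ℝ) ^ 2)

lemma edgeFinset_fromEdgeSet {V : Type} [Fintype V] {G : SimpleGraph V} {F : Finset (Sym2 V)}
    (hF : F ⊆ G.edgeFinset) {_ : Fintype (SimpleGraph.fromEdgeSet (F : Set (Sym2 V))).edgeSet} :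
    (SimpleGraph.fromEdgeSet (F : Set (Sym2 V))).edgeFinset = F := by
  ext e
  simp only [SimpleGraph.mem_edgeFinset, SimpleGraph.edgeSet_fromEdgeSet, Set.mem_sdiff, mem_coe]
  exact ⟨And.left, fun he =>
    ⟨he, G.not_isDiag_of_mem_edgeSet (SimpleGraph.mem_edgeFinset.1 (hF he))⟩⟩

section Counting

variable {V : Type} [Fintype V] [DecidableEq V]

lemma intEdges_eq_sum (G : SimpleGraph V) (S : Finset V) :
    (intEdges G S : ℝ) = ∑ e ∈ G.edgeFinset, if ∀ v ∈ e, v ∈ S then (1 : ℝ) else 0 := by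
  simp [intEdges]

lemma intEdges_univ (G : SimpleGraph V) : intEdges G univ = edgeCount G := by
  simp [intEdges, edgeCount]

lemma intEdges_le_edgeCount (G : SimpleGraph V) (S : Finset V) : intEdges G S ≤ edgeCount G :=
  card_le_card (filter_subset _ _)

lemma sum_degree_eq (G : SimpleGraph V) : ∑ v, (G.degree v : ℝ) = 2 * edgeCount G := by
  have h := G.sum_degrees_eq_twice_card_edges
  rw [edgeCount]
  exact_mod_cast h

lemma degSum_eq (G : SimpleGraph V) (S : Finset V) :
    (degSum G S : ℝ) = edgeCount G + intEdges G S - intEdges G Sᶜ := by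
  have hdeg (v : V) : (G.degree v : ℝ) = ∑ e ∈ G.edgeFinset, if v ∈ e then (1 : ℝ) else 0 := by
    rw [← G.card_incidenceFinset_eq_degree, G.incidenceFinset_eq_filter]
    simp
  have hm : (edgeCount G : ℝ) = ∑ e ∈ G.edgeFinset, (1 : ℝ) := by simp [edgeCount]
  rw [intEdges_eq_sum, intEdges_eq_sum, hm, degSum, Nat.cast_sum, sum_congr rfl fun v _ => hdeg v,
    sum_comm, ← sum_add_distrib, ← sum_sub_distrib]
  refine sum_congr rfl fun e he => ?_
  induction e with
  | _ a b =>
    have hab : a ≠ b := by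
      simp only [SimpleGraph.mem_edgeFinset, SimpleGraph.mem_edgeSet] at he
      exact he.ne
    have hends : (∑ v ∈ S, if v ∈ s(a, b) then (1 : ℝ) else 0)
        = (if a ∈ S then 1 else 0) + if b ∈ S then 1 else 0 := by
      rw [← sum_ite_eq' S a fun _ => (1 : ℝ), ← sum_ite_eq' S b fun _ => (1 : ℝ),
        ← sum_add_distrib]
      refine sum_congr rfl fun v _ => ?_
      by_cases h1 : v = a <;> by_cases h2 : v = b <;> simp_all
    rw [hends]
    simp only [Sym2.mem_iff, forall_eq_or_imp, forall_eq, mem_compl]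
    by_cases h1 : a ∈ S <;> by_cases h2 : b ∈ S <;> simp [h1, h2]

lemma four_mul_card_filter_mem_and_mem {ι : Type} [Fintype ι] [DecidableEq ι] (a b : ι) :
    4 * (∑ T : Finset ι, if a ∈ T ∧ b ∈ T then (1 : ℝ) else 0)
      = 2 ^ Fintype.card ι * (1 + if a = b then 1 else 0) := by
  have hIcc : (univ.filter fun T : Finset ι => a ∈ T ∧ b ∈ T) = Icc {a, b} univ := by
    ext T
    simp [insert_subset_iff]
  have hle : #({a, b} : Finset ι) ≤ Fintype.card ι := card_le_univ _
  rw [sum_boole, hIcc, card_Icc_finset (subset_univ _), card_univ]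
  obtain ⟨k, hk⟩ := Nat.exists_eq_add_of_le hle
  rw [hk, Nat.add_sub_cancel_left]
  by_cases h : a = b
  · subst h
    simp
    ring
  · simp [card_pair h, h]
    ring

variable (P : Finpartition (univ : Finset V))

lemma sum_parts_mem_and_mem (a b : V) :
    (∑ A ∈ P.parts, if a ∈ A ∧ b ∈ A then (1 : ℝ) else 0)
      = if P.part a = P.part b then 1 else 0 := by
  have h : ∀ A ∈ P.parts, (if a ∈ A ∧ b ∈ A then (1 : ℝ) else 0)
      = if P.part a = A then (if P.part a = P.part b then 1 else 0) else 0 := by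
    intro A hA
    simp only [← P.part_eq_iff_mem hA]
    by_cases h1 : P.part a = A
    · subst h1
      simp [eq_comm]
    · simp [h1]
  rw [sum_congr rfl h, sum_ite_eq, if_pos (P.part_mem.2 (mem_univ a))]

/-- The union of the parts of `P` lying in `T`. -/
noncomputable def partUnion (T : Finset (Finset V)) : Finset V :=
  univ.filter fun v => P.part v ∈ T

lemma four_mul_sum_intEdges_partUnion (G : SimpleGraph V) :
    4 * ∑ T, (intEdges G (partUnion P T) : ℝ)
      = 2 ^ Fintype.card (Finset V) * (edgeCount G + ∑ A ∈ P.parts, (intEdges G A : ℝ)) := by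
  have hm : (edgeCount G : ℝ) = ∑ e ∈ G.edgeFinset, (1 : ℝ) := by simp [edgeCount]
  simp only [intEdges_eq_sum]
  rw [sum_comm, sum_comm (s := P.parts), hm, ← sum_add_distrib, mul_sum, mul_sum]
  refine sum_congr rfl fun e _ => ?_
  induction e with
  | _ a b =>
    simp only [Sym2.mem_iff, forall_eq_or_imp, forall_eq, partUnion, mem_filter, mem_univ,
      true_and]
    rw [four_mul_card_filter_mem_and_mem, sum_parts_mem_and_mem]

lemma degSum_sq_eq (G : SimpleGraph V) (S : Finset V) :
    (degSum G S : ℝ) ^ 2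
      = ∑ a, ∑ b, (G.degree a : ℝ) * G.degree b * if a ∈ S ∧ b ∈ S then 1 else 0 := by
  have h : (degSum G S : ℝ) = ∑ v, (G.degree v : ℝ) * if v ∈ S then 1 else 0 := by
    simp [degSum]
  rw [h, sq, sum_mul_sum]
  refine sum_congr rfl fun a _ => sum_congr rfl fun b _ => ?_
  by_cases h1 : a ∈ S <;> by_cases h2 : b ∈ S <;> simp [h1, h2]

lemma four_mul_sum_degSum_sq_partUnion (G : SimpleGraph V) :
    4 * ∑ T, (degSum G (partUnion P T) : ℝ) ^ 2
      = 2 ^ Fintype.card (Finset V)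
        * (4 * (edgeCount G : ℝ) ^ 2 + ∑ A ∈ P.parts, (degSum G A : ℝ) ^ 2) := by
  have hm : 4 * (edgeCount G : ℝ) ^ 2 = ∑ a, ∑ b, (G.degree a : ℝ) * G.degree b := by
    rw [← sum_mul_sum, sum_degree_eq]
    ring
  simp only [degSum_sq_eq]
  rw [hm, sum_comm, sum_comm (s := P.parts), ← sum_add_distrib, mul_sum, mul_sum]
  refine sum_congr rfl fun a _ => ?_
  rw [sum_comm, sum_comm (s := P.parts), ← sum_add_distrib, mul_sum, mul_sum]
  refine sum_congr rfl fun b _ => ?_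
  simp only [← mul_sum, partUnion, mem_filter, mem_univ, true_and]
  rw [sum_parts_mem_and_mem, mul_left_comm, four_mul_card_filter_mem_and_mem]
  ring

/-- The modularity score is four times the average of `setScore` over unions of parts. -/
lemma four_mul_sum_setScore_partUnion (G : SimpleGraph V) (hG : edgeCount G ≠ 0) :
    4 * ∑ T, setScore G (partUnion P T) = 2 ^ Fintype.card (Finset V) * modScore G P := by
  have hm : (edgeCount G : ℝ) ≠ 0 := by exact_mod_cast hG
  simp only [setScore, modScore, if_neg hG, sum_sub_distrib, ← sum_div]
  rw [mul_sub, ← mul_div_assoc, ← mul_div_assoc, four_mul_sum_intEdges_partUnion,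
    four_mul_sum_degSum_sq_partUnion]
  field_simp
  ring

lemma abs_modScore_sub_le {G H : SimpleGraph V} (hG : edgeCount G ≠ 0) (hH : edgeCount H ≠ 0)
    {η : ℝ} (h : ∀ S, |setScore H S - setScore G S| ≤ η) :
    |modScore H P - modScore G P| ≤ 4 * η := by
  have hN : (0 : ℝ) < 2 ^ Fintype.card (Finset V) := by positivity
  have hsum : |∑ T, (setScore H (partUnion P T) - setScore G (partUnion P T))|
      ≤ 2 ^ Fintype.card (Finset V) * η := by
    refine (abs_sum_le_sum_abs _ _).trans ((sum_le_sum fun T _ => h (partUnion P T)).trans ?_)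
    simp
  have heq : 4 * ∑ T, (setScore H (partUnion P T) - setScore G (partUnion P T))
      = 2 ^ Fintype.card (Finset V) * (modScore H P - modScore G P) := by
    rw [sum_sub_distrib, mul_sub, four_mul_sum_setScore_partUnion P H hH,
      four_mul_sum_setScore_partUnion P G hG]
    ring
  have habs := congrArg abs heq
  rw [abs_mul, abs_mul, abs_of_pos hN, abs_of_pos (by norm_num : (0 : ℝ) < 4)] at habs
  refine le_of_mul_le_mul_left ?_ hN
  linarith

lemma abs_modularity_sub_le {G H : SimpleGraph V} {η : ℝ}
    (h : ∀ P : Finpartition (univ : Finset V), |modScore H P - modScore G P| ≤ η) :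
    |modularity H - modularity G| ≤ η := by
  have : Nonempty (Finpartition (univ : Finset V)) := ⟨⊥⟩
  have key {G H : SimpleGraph V}
      (h : ∀ P : Finpartition (univ : Finset V), |modScore H P - modScore G P| ≤ η) :
      modularity H ≤ modularity G + η :=
    ciSup_le fun P => by
      have h1 : modScore G P ≤ modularity G := le_ciSup (Set.finite_range _).bddAbove P
      have h2 := (abs_le.1 (h P)).2
      linarith
  have h1 := key h
  have h2 := key (G := H) (H := G) fun P => by rw [abs_sub_comm]; exact h P
  rw [abs_le]
  constructor <;> linarith

lemma setScore_eq (G : SimpleGraph V) (hG : edgeCount G ≠ 0) (S : Finset V) :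
    setScore G S = (intEdges G S : ℝ) / edgeCount G
      - ((1 + (intEdges G S : ℝ) / edgeCount G - (intEdges G Sᶜ : ℝ) / edgeCount G) / 2) ^ 2 := by
  have hm : (edgeCount G : ℝ) ≠ 0 := by exact_mod_cast hG
  rw [setScore, degSum_eq]
  field_simp
  ring

lemma abs_setScore_sub_le {G H : SimpleGraph V} (hG : edgeCount G ≠ 0) (hH : edgeCount H ≠ 0)
    {η : ℝ} (h : ∀ S, |(intEdges H S : ℝ) / edgeCount H - (intEdges G S : ℝ) / edgeCount G| ≤ η)
    (S : Finset V) : |setScore H S - setScore G S| ≤ 3 * η := by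
  have hunit (K : SimpleGraph V) (A : Finset V) :
      0 ≤ (intEdges K A : ℝ) / edgeCount K ∧ (intEdges K A : ℝ) / edgeCount K ≤ 1 :=
    ⟨by positivity,
      div_le_one_of_le₀ (by exact_mod_cast intEdges_le_edgeCount K A) (by positivity)⟩
  rw [setScore_eq G hG, setScore_eq H hH]
  obtain ⟨hx0, hx1⟩ := hunit G S
  obtain ⟨hy0, hy1⟩ := hunit G Sᶜ
  obtain ⟨hx0', hx1'⟩ := hunit H S
  obtain ⟨hy0', hy1'⟩ := hunit H Sᶜ
  have hx := abs_le.1 (h S)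
  have hy := abs_le.1 (h Sᶜ)
  generalize (intEdges G S : ℝ) / edgeCount G = x at *
  generalize (intEdges H S : ℝ) / edgeCount H = x' at *
  generalize (intEdges G Sᶜ : ℝ) / edgeCount G = y at *
  generalize (intEdges H Sᶜ : ℝ) / edgeCount H = y' at *
  have hd : |(x' - x - (y' - y)) / 2| ≤ η := by
    rw [abs_le]
    constructor <;> linarith
  have hs : |(1 + x' - y') / 2 + (1 + x - y) / 2| ≤ 2 := by
    rw [abs_le]
    constructor <;> linarith
  have hprod := mul_le_mul hd hs (abs_nonneg _) ((abs_nonneg _).trans hd)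
  rw [← abs_mul] at hprod
  have := abs_le.1 hprod
  rw [abs_le]
  constructor <;> nlinarith

lemma abs_density_sub_le {G H : SimpleGraph V} {p δ : ℝ} (hp : 0 < p) (hG : edgeCount G ≠ 0)
    (hH : edgeCount H ≠ 0)
    (h : ∀ S, |(intEdges H S : ℝ) - p * intEdges G S| ≤ δ * (p * edgeCount G)) (S : Finset V) :
    |(intEdges H S : ℝ) / edgeCount H - (intEdges G S : ℝ) / edgeCount G| ≤ 2 * δ := by
  have hm : (0 : ℝ) < edgeCount G := by exact_mod_cast Nat.pos_of_ne_zero hG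
  have hm' : (0 : ℝ) < edgeCount H := by exact_mod_cast Nat.pos_of_ne_zero hH
  have hpm := mul_pos hp hm
  have hU := h univ
  rw [intEdges_univ, intEdges_univ] at hU
  have hx1 : (intEdges H S : ℝ) / edgeCount H ≤ 1 :=
    div_le_one_of_le₀ (by exact_mod_cast intEdges_le_edgeCount H S) hm'.le
  have hx0 : 0 ≤ (intEdges H S : ℝ) / edgeCount H := by positivity
  have heq : (intEdges H S : ℝ) / edgeCount H - (intEdges G S : ℝ) / edgeCount G
      = ((intEdges H S - p * intEdges G S)
        - (intEdges H S : ℝ) / edgeCount H * (edgeCount H - p * edgeCount G))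
        / (p * edgeCount G) := by
    field_simp
    ring
  rw [heq, abs_div, abs_of_pos hpm, div_le_iff₀ hpm]
  refine (abs_sub _ _).trans ?_
  rw [abs_mul, abs_of_nonneg hx0]
  have := mul_le_mul hx1 hU (abs_nonneg _) zero_le_one
  linarith [h S]

lemma abs_modularity_sub_le_of_intEdges {G H : SimpleGraph V} {p δ : ℝ} (hp : 0 < p) (hδ : δ < 1)
    (hG : edgeCount G ≠ 0)
    (h : ∀ S, |(intEdges H S : ℝ) - p * intEdges G S| ≤ δ * (p * edgeCount G)) :
    |modularity H - modularity G| ≤ 24 * δ := by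
  have hm : (0 : ℝ) < edgeCount G := by exact_mod_cast Nat.pos_of_ne_zero hG
  have hH : edgeCount H ≠ 0 := by
    intro h0
    have hU := h univ
    rw [intEdges_univ, intEdges_univ, h0, Nat.cast_zero, zero_sub, abs_neg,
      abs_of_pos (mul_pos hp hm)] at hU
    nlinarith [mul_pos hp hm]
  refine (abs_modularity_sub_le fun P => abs_modScore_sub_le P hG hH
    (abs_setScore_sub_le hG hH (abs_density_sub_le hp hG hH h))).trans ?_
  linarith

lemma intEdges_fromEdgeSet {G : SimpleGraph V} {F : Finset (Sym2 V)} (hF : F ⊆ G.edgeFinset)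
    (S : Finset V) :
    intEdges (SimpleGraph.fromEdgeSet (F : Set (Sym2 V))) S
      = #(F.filter fun e => ∀ v ∈ e, v ∈ S) := by
  rw [intEdges, edgeFinset_fromEdgeSet hF]

end Counting

section RandomSubset

variable {α : Type} {p : ℝ}

/-- The probability that a `p`-random subset of `E` equals `F`. -/
noncomputable def subsetWeight (E : Finset α) (p : ℝ) (F : Finset α) : ℝ :=
  p ^ #F * (1 - p) ^ (#E - #F)

lemma subsetWeight_nonneg (hp0 : 0 ≤ p) (hp1 : p ≤ 1) (E F : Finset α) :
    0 ≤ subsetWeight E p F :=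
  mul_nonneg (pow_nonneg hp0 _) (pow_nonneg (sub_nonneg.2 hp1) _)

lemma sum_subsetWeight_mul_prod (E : Finset α) (p : ℝ) (g : α → ℝ) :
    ∑ F ∈ E.powerset, subsetWeight E p F * ∏ e ∈ F, g e = ∏ e ∈ E, (p * g e + (1 - p)) := by
  rw [prod_add]
  refine sum_congr rfl fun F hF => ?_
  rw [prod_mul_distrib, prod_const, prod_const, card_sdiff_of_subset (mem_powerset.1 hF),
    subsetWeight]
  ring

lemma sum_subsetWeight (E : Finset α) (p : ℝ) : ∑ F ∈ E.powerset, subsetWeight E p F = 1 := by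
  simpa using sum_subsetWeight_mul_prod E p fun _ => 1

lemma sum_subsetWeight_mul_exp_le (hp0 : 0 ≤ p) (hp1 : p ≤ 1) (E : Finset α) (Q : α → Prop)
    [DecidablePred Q] {t : ℝ} (ht : |t| ≤ 1) :
    ∑ F ∈ E.powerset, subsetWeight E p F * Real.exp (t * (#(F.filter Q) - p * #(E.filter Q)))
      ≤ Real.exp (p * #E * t ^ 2) := by
  have hprod (F : Finset α) :
      Real.exp (t * #(F.filter Q)) = ∏ e ∈ F, if Q e then Real.exp t else 1 := by
    rw [prod_ite, prod_const, prod_const_one, mul_one, mul_comm, Real.exp_nat_mul]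
  have hmgf : ∑ F ∈ E.powerset, subsetWeight E p F * Real.exp (t * #(F.filter Q))
      ≤ Real.exp (#(E.filter Q) * (p * (Real.exp t - 1))) := by
    simp only [hprod]
    rw [sum_subsetWeight_mul_prod]
    calc ∏ e ∈ E, (p * (if Q e then Real.exp t else 1) + (1 - p))
        ≤ ∏ e ∈ E, (if Q e then Real.exp (p * (Real.exp t - 1)) else 1) := by
          refine prod_le_prod (fun e _ => ?_) fun e _ => ?_
          · have : 0 ≤ 1 - p := sub_nonneg.2 hp1
            split_ifs <;> positivity
          · split_ifs
            · linarith [Real.add_one_le_exp (p * (Real.exp t - 1))]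
            · linarith
      _ = _ := by rw [prod_ite, prod_const, prod_const_one, mul_one, Real.exp_nat_mul]
  have hsplit (F : Finset α) :
      subsetWeight E p F * Real.exp (t * (#(F.filter Q) - p * #(E.filter Q)))
        = subsetWeight E p F * Real.exp (t * #(F.filter Q))
          * Real.exp (-(t * (p * #(E.filter Q)))) := by
    rw [mul_assoc, ← Real.exp_add]
    ring_nf
  simp only [hsplit]
  rw [← sum_mul]
  refine (mul_le_mul_of_nonneg_right hmgf (Real.exp_pos _).le).trans ?_
  rw [← Real.exp_add, Real.exp_le_exp]
  have hexp : Real.exp t - 1 - t ≤ t ^ 2 := (abs_le.1 (Real.abs_exp_sub_one_sub_id_le ht)).2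
  have hk : (#(E.filter Q) : ℝ) ≤ #E := by exact_mod_cast card_le_card (filter_subset _ _)
  calc #(E.filter Q) * (p * (Real.exp t - 1)) + -(t * (p * #(E.filter Q)))
      = p * #(E.filter Q) * (Real.exp t - 1 - t) := by ring
    _ ≤ p * #(E.filter Q) * t ^ 2 := by gcongr
    _ ≤ p * #E * t ^ 2 := by gcongr

/-- A Chernoff bound for the number of elements of a `p`-random subset satisfying `Q`. -/
lemma sum_subsetWeight_deviation_le (hp0 : 0 ≤ p) (hp1 : p ≤ 1) (E : Finset α) (Q : α → Prop)
    [DecidablePred Q] {δ : ℝ} (hδ0 : 0 ≤ δ) (hδ1 : δ ≤ 1) :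
    (∑ F ∈ E.powerset, if δ * (p * #E) < |(#(F.filter Q) : ℝ) - p * #(E.filter Q)|
      then subsetWeight E p F else 0) ≤ 2 * Real.exp (-(δ ^ 2 / 4 * (p * #E))) := by
  have ht : |δ / 2| ≤ 1 := by
    rw [abs_le]
    constructor <;> linarith
  have hup := sum_subsetWeight_mul_exp_le hp0 hp1 E Q ht
  have hlow := sum_subsetWeight_mul_exp_le hp0 hp1 E Q (t := -(δ / 2)) (by rwa [abs_neg])
  set c := Real.exp (-(δ / 2 * (δ * (p * #E)))) with hc
  have hpoint : ∀ F ∈ E.powerset,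
      (if δ * (p * #E) < |(#(F.filter Q) : ℝ) - p * #(E.filter Q)|
        then subsetWeight E p F else 0)
      ≤ subsetWeight E p F * Real.exp (δ / 2 * (#(F.filter Q) - p * #(E.filter Q))) * c
        + subsetWeight E p F * Real.exp (-(δ / 2) * (#(F.filter Q) - p * #(E.filter Q))) * c := by
    intro F _
    have hw := subsetWeight_nonneg hp0 hp1 E F
    have hone {x : ℝ} (hx : 0 ≤ x) : subsetWeight E p F ≤ subsetWeight E p F * Real.exp x :=
      le_mul_of_one_le_right hw (Real.one_le_exp hx)
    split_ifs with hF
    · rw [mul_assoc, mul_assoc, hc, ← Real.exp_add, ← Real.exp_add]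
      rcases lt_abs.1 hF with h | h
      · refine (hone ?_).trans (le_add_of_nonneg_right (by positivity))
        nlinarith
      · refine (hone ?_).trans (le_add_of_nonneg_left (by positivity))
        nlinarith
    · positivity
  refine (sum_le_sum hpoint).trans ?_
  rw [sum_add_distrib, ← sum_mul, ← sum_mul]
  have hcpos : 0 ≤ c := (Real.exp_pos _).le
  refine (add_le_add (mul_le_mul_of_nonneg_right hup hcpos)
    (mul_le_mul_of_nonneg_right hlow hcpos)).trans (le_of_eq ?_)
  rw [hc, ← Real.exp_add, ← Real.exp_add, two_mul]
  congr 2 <;> ring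

end RandomSubset

lemma one_sub_le_subgraphProb {V : Type} [Fintype V] [DecidableEq V] (G : SimpleGraph V)
    {p δ : ℝ} (hp0 : 0 ≤ p) (hp1 : p ≤ 1) (hδ0 : 0 ≤ δ) (hδ1 : δ ≤ 1) (Q : SimpleGraph V → Prop)
    (hQ : ∀ H : SimpleGraph V,
      (∀ S, |(intEdges H S : ℝ) - p * intEdges G S| ≤ δ * (p * edgeCount G)) → Q H) :
    1 - 2 ^ Fintype.card V * (2 * Real.exp (-(δ ^ 2 / 4 * (p * edgeCount G))))
      ≤ subgraphProb G p Q := by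
  set w := subsetWeight G.edgeFinset p with hw
  have hw0 (F) : 0 ≤ w F := subsetWeight_nonneg hp0 hp1 _ F
  let bad (S : Finset V) (F : Finset (Sym2 V)) : ℝ :=
    if δ * (p * #G.edgeFinset) < |(#(F.filter fun e => ∀ v ∈ e, v ∈ S) : ℝ)
      - p * #(G.edgeFinset.filter fun e => ∀ v ∈ e, v ∈ S)| then w F else 0
  have hbad0 (S F) : 0 ≤ bad S F := by
    simp only [bad]
    split_ifs
    exacts [hw0 F, le_rfl]
  have hpoint : ∀ F ∈ G.edgeFinset.powerset,
      w F - ∑ S, bad S F ≤ if Q (SimpleGraph.fromEdgeSet (F : Set (Sym2 V))) then w F else 0 := by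
    intro F hF
    split_ifs with hQF
    · exact sub_le_self _ (sum_nonneg fun S _ => hbad0 S F)
    · obtain ⟨S, hS⟩ := not_forall.1 (mt (hQ _) hQF)
      rw [intEdges_fromEdgeSet (mem_powerset.1 hF), not_le] at hS
      have hbadS : bad S F = w F := if_pos hS
      have := single_le_sum (fun S _ => hbad0 S F) (mem_univ S)
      linarith
  have hunion : ∑ F ∈ G.edgeFinset.powerset, ∑ S, bad S F
      ≤ 2 ^ Fintype.card V * (2 * Real.exp (-(δ ^ 2 / 4 * (p * edgeCount G)))) := by
    rw [sum_comm]
    refine (sum_le_sum fun S _ =>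
      sum_subsetWeight_deviation_le hp0 hp1 G.edgeFinset (fun e => ∀ v ∈ e, v ∈ S) hδ0 hδ1).trans
        (le_of_eq ?_)
    simp [edgeCount]
  have htotal := sum_le_sum hpoint
  rw [sum_sub_distrib, hw, sum_subsetWeight] at htotal
  have heq : subgraphProb G p Q = ∑ F ∈ G.edgeFinset.powerset,
      if Q (SimpleGraph.fromEdgeSet (F : Set (Sym2 V))) then subsetWeight G.edgeFinset p F
      else 0 := rfl
  rw [heq]
  linarith

lemma two_pow_mul_exp_le {ε x : ℝ} (hε : 0 < ε) {n : ℕ} (hn : 0 < n)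
    (hx : (1 + 2 / ε) * n ≤ x) : 2 ^ n * (2 * Real.exp (-x)) ≤ ε := by
  have hn1 : (1 : ℝ) ≤ n := by exact_mod_cast hn
  have h2 : (2 : ℝ) ^ n ≤ Real.exp n := by
    rw [← mul_one (n : ℝ), Real.exp_nat_mul]
    gcongr
    linarith [Real.add_one_le_exp 1]
  have hn2 : 2 / ε ≤ 2 / ε * n := le_mul_of_one_le_right (by positivity) hn1
  calc 2 ^ n * (2 * Real.exp (-x)) ≤ Real.exp n * (2 * Real.exp (-x)) := by gcongr
    _ = 2 * Real.exp (n - x) := by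
      rw [sub_eq_add_neg, Real.exp_add]
      ring
    _ ≤ 2 * Real.exp (-(2 / ε)) := by
      gcongr
      linarith
    _ ≤ ε := by
      have h := Real.add_one_le_exp (2 / ε)
      rw [Real.exp_neg, ← div_eq_mul_inv, div_le_iff₀ (Real.exp_pos _)]
      calc (2 : ℝ) = ε * (2 / ε) := by field_simp
        _ ≤ ε * Real.exp (2 / ε) := by
          gcongr
          linarith

/-- Theorem 2(a): for every ε > 0 there is c = c(ε) > 0 such that for every finite
graph G with at least one vertex and probability 0 < p ≤ 1 with e(G)·p / v(G) ≥ c,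
with probability at least 1 − ε we have |q*(G_p) − q*(G)| < ε. -/
theorem statement1 :
    ∀ ε : ℝ, 0 < ε →
      ∃ c : ℝ, 0 < c ∧
        ∀ (V : Type) [Fintype V] [DecidableEq V] [Nonempty V] (G : SimpleGraph V) (p : ℝ),
          0 < p → p ≤ 1 → c ≤ (edgeCount G : ℝ) * p / (Fintype.card V : ℝ) →
          1 - ε ≤ subgraphProb G p (fun H => |modularity H - modularity G| < ε) := by
  intro ε hε
  set δ := min (1 / 2) (ε / 48) with hδ
  have hδ0 : 0 < δ := lt_min (by norm_num) (by positivity)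
  have hδ1 : δ ≤ 1 / 2 := min_le_left _ _
  have hδε : δ ≤ ε / 48 := min_le_right _ _
  refine ⟨4 / δ ^ 2 * (1 + 2 / ε), by positivity, ?_⟩
  intro V _ _ _ G p hp0 hp1 hc
  have hn : 0 < Fintype.card V := Fintype.card_pos
  rw [le_div_iff₀ (by exact_mod_cast hn)] at hc
  have hG : edgeCount G ≠ 0 := by
    intro h0
    rw [h0, Nat.cast_zero, zero_mul] at hc
    have : (0 : ℝ) < Fintype.card V := by exact_mod_cast hn
    exact absurd hc (not_le.2 (by positivity))
  have htail : 2 ^ Fintype.card V * (2 * Real.exp (-(δ ^ 2 / 4 * (p * edgeCount G)))) ≤ ε := by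
    refine two_pow_mul_exp_le hε hn ?_
    calc (1 + 2 / ε) * Fintype.card V
        = δ ^ 2 / 4 * (4 / δ ^ 2 * (1 + 2 / ε) * Fintype.card V) := by field_simp
      _ ≤ δ ^ 2 / 4 * (edgeCount G * p) := by gcongr
      _ = δ ^ 2 / 4 * (p * edgeCount G) := by ring
  refine le_trans (by linarith) (one_sub_le_subgraphProb G hp0.le hp1 hδ0.le (by linarith) _
    fun H hH => (abs_modularity_sub_le_of_intEdges hp0 (by linarith) hG hH).trans_lt ?_)
  linarith
end
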